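/- arXiv:2605.25922 — 2 statements merged into one kernel-verified Lean document; each statement's English description precedes it below -/
import Mathlib

section
/- Let V ≥ 1 views be partitioned into a consistent set 𝒢 with |𝒢| = M ≥ 1 and an outlier set ℬ with |ℬ| = V − M. Let score₁, …, score_V be real numbers, let τ > 0, and define the softmax weights α_i = exp(score_i/τ) / Σ_{r=1}^{V} exp(score_r/τ). Assume there exist real numbers a > b such that score_i ≥ a for every i ∈ 𝒢 and score_j ≤ b for every j ∈ ℬ. Then the total outlier weight satisfies Σ_{j ∈ ℬ} α_j ≤ (V − M) / (M · exp((a − b)/τ) + (V − M)). -/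
/-- Outlier suppression by similarity-softmax weighting
(paper's Theorem outlier). -/
theorem stmt_4 {ι : Type*} [Fintype ι] [DecidableEq ι] (G B : Finset ι)
    (hpart : G ∪ B = Finset.univ) (hdisj : Disjoint G B) (hM : G.Nonempty)
    (score : ι → ℝ) (τ a b : ℝ) (hτ : 0 < τ) (hab : b < a)
    (hG : ∀ i ∈ G, a ≤ score i) (hB : ∀ j ∈ B, score j ≤ b) :
    ∑ j ∈ B, Real.exp (score j / τ) / (∑ r, Real.exp (score r / τ))
      ≤ (B.card : ℝ) / ((G.card : ℝ) * Real.exp ((a - b) / τ) + (B.card : ℝ)) := by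
  have hGsum : (G.card : ℝ) * Real.exp (a / τ) ≤ ∑ i ∈ G, Real.exp (score i / τ) := by
    rw [← nsmul_eq_mul]
    refine Finset.card_nsmul_le_sum _ _ _ fun i hi => ?_
    have := hG i hi
    gcongr
  have hBsum : ∑ j ∈ B, Real.exp (score j / τ) ≤ (B.card : ℝ) * Real.exp (b / τ) := by
    rw [← nsmul_eq_mul]
    refine Finset.sum_le_card_nsmul _ _ _ fun j hj => ?_
    have := hB j hj
    gcongr
  have hexp : Real.exp (b / τ) * Real.exp ((a - b) / τ) = Real.exp (a / τ) := by
    rw [← Real.exp_add]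
    congr 1
    ring
  have hcard : (0 : ℝ) < G.card := by exact_mod_cast hM.card_pos
  rw [← Finset.sum_div, ← hpart, Finset.sum_union hdisj]
  have hBnonneg : 0 ≤ ∑ j ∈ B, Real.exp (score j / τ) :=
    Finset.sum_nonneg fun j _ => (Real.exp_pos _).le
  have hGpos : 0 < ∑ i ∈ G, Real.exp (score i / τ) :=
    Finset.sum_pos (fun i _ => Real.exp_pos _) hM
  rw [div_le_div_iff₀ (by positivity) (by positivity), mul_add, mul_add,
    mul_comm (B.card : ℝ) (∑ j ∈ B, _)]
  gcongr ?_ + _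
  calc
    (∑ j ∈ B, Real.exp (score j / τ)) * (G.card * Real.exp ((a - b) / τ))
        ≤ (B.card * Real.exp (b / τ)) * (G.card * Real.exp ((a - b) / τ)) := by gcongr
    _ = B.card * (G.card * Real.exp (a / τ)) := by rw [← hexp]; ring
    _ ≤ B.card * ∑ i ∈ G, Real.exp (score i / τ) := by gcongr
end

section
/- Let Ω be a nonempty complete metric space of unit feature vectors in a real inner product space, let w₁, …, w_C be unit vectors (class prototypes), and for z ∈ Ω define the predicted label as an index maximising the cosine scores ⟨z, w_c⟩. Let x ↦ H_x be a family of maps H_x : W → Ω for a metric space W, let G : Ω → W, and suppose that for the fixed input x and perturbation δ the composed maps T = H_{x+δ} ∘ G and S = H_x ∘ G are contractions on Ω with common factor q ∈ [0, 1), and that d(H_{x+δ}(w), H_x(w)) ≤ L_x · ‖δ‖ for all w ∈ G(Ω) with L_x > 0. Let z⋆(x) and z⋆(x+δ) be the respective unique fixed points. If the clean fixed point z⋆(x) satisfies the margin condition ⟨z⋆(x), w_y⟩ − max_{c ≠ y} ⟨z⋆(x), w_c⟩ ≥ γ for some γ > 0 and the perturbation satisfies ‖δ‖ ≤ γ(1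 − q)/(2 L_x), then y remains a maximiser of the scores ⟨z⋆(x+δ), w_c⟩, i.e. the prediction is unchanged by the perturbation. -/
open scoped RealInnerProductSpace

/-- If `S` is a `q`-contraction with fixed point `v`, then a fixed point `u` of a map `T` that is
`ε`-close to `S` at `u` satisfies `(1 - q) * dist u v ≤ ε`. -/
theorem one_sub_mul_dist_fixedPoints_le {α : Type*} [PseudoMetricSpace α] {S T : α → α}
    {q ε : ℝ} {u v : α} (hS : dist (S u) (S v) ≤ q * dist u v)
    (hTS : dist (T u) (S u) ≤ ε) (hu : T u = u) (hv : S v = v) :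
    (1 - q) * dist u v ≤ ε := by
  have h := dist_triangle (T u) (S u) (S v)
  rw [hu, hv] at h
  rw [hu] at hTS
  rw [hv] at hS
  linarith

/-- A margin `γ` between the scores of two unit prototypes tolerates feature perturbations of
norm at most `γ / 2`. -/
theorem inner_le_inner_of_margin {E : Type*} [NormedAddCommGroup E] [InnerProductSpace ℝ E]
    {z z' a b : E} {γ : ℝ} (ha : ‖a‖ = 1) (hb : ‖b‖ = 1)
    (hmargin : γ ≤ ⟪z, b⟫ - ⟪z, a⟫) (hz : ‖z' - z‖ ≤ γ / 2) :
    ⟪z', a⟫ ≤ ⟪z', b⟫ := by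
  have h₁ := real_inner_le_norm (z' - z) a
  have h₂ := neg_le_of_abs_le (abs_real_inner_le_norm (z' - z) b)
  rw [inner_sub_left, ha] at h₁
  rw [inner_sub_left, hb] at h₂
  linarith

/-- Prediction invariance of the closed-loop fixed point under bounded input
perturbations: combines the paper's Theorem 2 with its margin lemma. -/
theorem stmt_6 {E : Type*} [NormedAddCommGroup E] [InnerProductSpace ℝ E]
    (Ω : Set E) [Nonempty Ω] [CompleteSpace Ω]
    (hunit : ∀ z ∈ Ω, ‖z‖ = 1)
    {W X : Type*} [MetricSpace W] [NormedAddCommGroup X] [NormedSpace ℝ X]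
    (G : Ω → W) (H : X → W → Ω) (x δ : X) (q Lx : ℝ)
    (hq0 : 0 ≤ q) (hq1 : q < 1) (hLx : 0 < Lx)
    (hT : ∀ u v : Ω, dist (H (x + δ) (G u)) (H (x + δ) (G v)) ≤ q * dist u v)
    (hS : ∀ u v : Ω, dist (H x (G u)) (H x (G v)) ≤ q * dist u v)
    (hlip : ∀ w ∈ Set.range G, dist (H (x + δ) w) (H x w) ≤ Lx * ‖δ‖)
    (zadv zcl : Ω) (hadv : H (x + δ) (G zadv) = zadv) (hcl : H x (G zcl) = zcl)
    {C : ℕ} (w : Fin C → E) (hw : ∀ c, ‖w c‖ = 1)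
    (y : Fin C) (γ : ℝ) (hγ : 0 < γ)
    (hmax : ∀ c, ⟪(zcl : E), w c⟫ ≤ ⟪(zcl : E), w y⟫)
    (hmargin : ∀ c, c ≠ y → ⟪(zcl : E), w y⟫ - ⟪(zcl : E), w c⟫ ≥ γ)
    (hδ : ‖δ‖ ≤ γ * (1 - q) / (2 * Lx)) :
    ∀ c, ⟪(zadv : E), w c⟫ ≤ ⟪(zadv : E), w y⟫ := by
  intro c
  rcases eq_or_ne c y with rfl | hc
  · exact le_rfl
  have hd : (1 - q) * dist zadv zcl ≤ Lx * ‖δ‖ :=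
    one_sub_mul_dist_fixedPoints_le (S := fun z => H x (G z)) (T := fun z => H (x + δ) (G z))
      (hS zadv zcl) (hlip _ ⟨zadv, rfl⟩) hadv hcl
  rw [le_div_iff₀ (by positivity)] at hδ
  have hhalf : dist zadv zcl ≤ γ / 2 :=
    le_of_mul_le_mul_left (by linarith) (sub_pos.2 hq1)
  rw [Subtype.dist_eq, dist_eq_norm] at hhalf
  exact inner_le_inner_of_margin (hw c) (hw y) (hmargin c hc) hhalf
end
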